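/- Let σ > 0 and m, Δ ∈ ℝ. Let f_0 and f_Δ denote the probability density functions of the Gaussian laws N(m, σ²) and N(m + Δ, σ²) on ℝ, and let μ̄ = N(m, σ²). Then ∫_ℝ (log f_Δ(x) − log f_0(x))² dμ̄(x) = Δ²/σ² + Δ⁴/(4σ⁴). -/

import Mathlib

open MeasureTheory ProbabilityTheory

open scoped NNReal

lemma log_gaussianPDFReal_add_sub_log_gaussianPDFReal (m Δ : ℝ) {v : ℝ≥0} (hv : v ≠ 0) (x : ℝ) :
    Real.log (gaussianPDFReal (m + Δ) v x) - Real.log (gaussianPDFReal m v x)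
      = Δ / v * (x - m) - Δ ^ 2 / (2 * v) := by
  have hv' : (0 : ℝ) < v := NNReal.coe_pos.2 (pos_iff_ne_zero.2 hv)
  have hc : (Real.sqrt (2 * Real.pi * v))⁻¹ ≠ 0 := by positivity
  simp only [gaussianPDFReal]
  rw [Real.log_mul hc (Real.exp_ne_zero _), Real.log_mul hc (Real.exp_ne_zero _),
    Real.log_exp, Real.log_exp]
  field_simp
  ring

lemma integral_affine_sq_gaussianReal (m a b : ℝ) (v : ℝ≥0) :
    ∫ x, (a * (x - m) - b) ^ 2 ∂(gaussianReal m v) = a ^ 2 * v + b ^ 2 := by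
  have hL : MemLp (fun x : ℝ ↦ x - m) 2 (gaussianReal m v) :=
    (memLp_id_gaussianReal' 2 (by simp)).sub (memLp_const m)
  have hid : Integrable (fun x : ℝ ↦ x) (gaussianReal m v) :=
    (memLp_id_gaussianReal 1).integrable le_rfl
  have hsub : Integrable (fun x : ℝ ↦ x - m) (gaussianReal m v) := hL.integrable (by simp)
  have hmean : ∫ x, (x - m) ∂(gaussianReal m v) = 0 := by
    rw [integral_sub hid (integrable_const m), integral_id_gaussianReal]
    simp
  have hvar : ∫ x, (x - m) ^ 2 ∂(gaussianReal m v) = v := by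
    rw [← variance_fun_id_gaussianReal (μ := m) (v := v), variance_eq_integral (by fun_prop),
      integral_id_gaussianReal]
  calc ∫ x, (a * (x - m) - b) ^ 2 ∂(gaussianReal m v)
      = ∫ x, (a ^ 2 * (x - m) ^ 2 - 2 * a * b * (x - m) + b ^ 2) ∂(gaussianReal m v) := by
        congr with x
        ring
    _ = a ^ 2 * v + b ^ 2 := by
        have hsq := hL.integrable_sq.const_mul (a ^ 2)
        have hlin := hsub.const_mul (2 * a * b)
        have hdiff : Integrable (fun x : ℝ ↦ a ^ 2 * (x - m) ^ 2 - 2 * a * b * (x - m))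
            (gaussianReal m v) := hsq.sub hlin
        rw [integral_add hdiff (integrable_const _), integral_sub hsq hlin,
          integral_const_mul, integral_const_mul, hmean, hvar]
        simp

lemma integral_sq_log_gaussianPDFReal_add_sub_log (m Δ : ℝ) {v : ℝ≥0} (hv : v ≠ 0) :
    ∫ x, (Real.log (gaussianPDFReal (m + Δ) v x) - Real.log (gaussianPDFReal m v x)) ^ 2
        ∂(gaussianReal m v)
      = Δ ^ 2 / v + Δ ^ 4 / (4 * (v : ℝ) ^ 2) := by
  have hv' : (v : ℝ) ≠ 0 := NNReal.coe_ne_zero.2 hv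
  simp_rw [log_gaussianPDFReal_add_sub_log_gaussianPDFReal m Δ hv]
  rw [integral_affine_sq_gaussianReal]
  field_simp
  ring

/-- Log-density effect size under a Gaussian mean shift: with `f_0`, `f_Δ` the densities
of `N(m, σ²)`, `N(m+Δ, σ²)` and `μ̄ = N(m, σ²)`,
`∫ (log f_Δ − log f_0)² dμ̄ = Δ²/σ² + Δ⁴/(4σ⁴)`. -/
theorem gaussian_log_density_effect_size
    (σ : ℝ) (hσ : 0 < σ) (m Δ : ℝ) :
    ∫ x, (Real.log (gaussianPDFReal (m + Δ) ⟨σ ^ 2, sq_nonneg σ⟩ x)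
          - Real.log (gaussianPDFReal m ⟨σ ^ 2, sq_nonneg σ⟩ x)) ^ 2
        ∂(gaussianReal m ⟨σ ^ 2, sq_nonneg σ⟩)
      = Δ ^ 2 / σ ^ 2 + Δ ^ 4 / (4 * σ ^ 4) := by
  have hv : (⟨σ ^ 2, sq_nonneg σ⟩ : ℝ≥0) ≠ 0 := fun h ↦
    (pow_pos hσ 2).ne' (congrArg NNReal.toReal h)
  refine (integral_sq_log_gaussianPDFReal_add_sub_log m Δ hv).trans ?_
  change Δ ^ 2 / σ ^ 2 + Δ ^ 4 / (4 * (σ ^ 2) ^ 2) = _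
  rw [← pow_mul]
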